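/- Green's Theorem 3: Assume char k ≠ 2. Let I ⊆ R = k[x_1,…,x_r] be a homogeneous ideal, d ≥ 1, and m a positive integer with m ≤ r − 1. Suppose that h_d = dim_k (R/I)_d = C(m+d, d) and that for a general linear form L one has dim_k (R/(I + (L)))_d = C(m−1+d, d). Then there exist linearly independent linear forms L_1,…,L_{r−m−1} ∈ R_1 such that I_d = R_{d−1}·span_k(L_1,…,L_{r−m−1}), i.e., the degree-d component of I equals the degree-d component of the ideal generated by L_1,…,L_{r−m−1}. -/

import Mathlib

open MvPolynomial

/-- The degree-`d` graded component of `R/I` (the image of the space of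
degree-`d` homogeneous polynomials in the quotient), as a `k`-submodule. -/
noncomputable def gradedPiece (k : Type*) [Field k] (r : ℕ)
    (I : Ideal (MvPolynomial (Fin r) k)) (d : ℕ) :
    Submodule k (MvPolynomial (Fin r) k ⧸ I) :=
  Submodule.map (Ideal.Quotient.mkₐ k I).toLinearMap
    (homogeneousSubmodule (Fin r) k d)

/-- The Hilbert function of `R/I` in degree `d`. -/
noncomputable def hilb (k : Type*) [Field k] (r : ℕ)
    (I : Ideal (MvPolynomial (Fin r) k)) (d : ℕ) : ℕ :=
  Module.finrank k (gradedPiece k r I d)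

/-- `I` is a homogeneous ideal. -/
def IsHomogIdeal {k : Type*} [Field k] {r : ℕ}
    (I : Ideal (MvPolynomial (Fin r) k)) : Prop :=
  ∀ f ∈ I, ∀ n : ℕ, homogeneousComponent n f ∈ I

/-- `I` contains no nonzero linear forms. -/
def NoLinearForms {k : Type*} [Field k] {r : ℕ}
    (I : Ideal (MvPolynomial (Fin r) k)) : Prop :=
  ∀ f ∈ I, f.IsHomogeneous 1 → f = 0

/-- The dimension of the degree-`i` component of the socle of `R/I`. -/
noncomputable def socDim (k : Type*) [Field k] (r : ℕ)
    (I : Ideal (MvPolynomial (Fin r) k)) (i : ℕ) : ℕ :=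
  Module.finrank k (Submodule.map (Ideal.Quotient.mkₐ k I).toLinearMap
    (homogeneousSubmodule (Fin r) k i ⊓
      ⨅ j : Fin r, Submodule.comap (LinearMap.mulLeft k (X j))
        (Submodule.restrictScalars k I)))

/-- `R/I` is a standard graded artinian algebra:
`I` is homogeneous and `R/I` is finite-dimensional over `k`. -/
def StdArtinian (k : Type*) [Field k] (r : ℕ)
    (I : Ideal (MvPolynomial (Fin r) k)) : Prop :=
  IsHomogIdeal I ∧ Module.Finite k (MvPolynomial (Fin r) k ⧸ I)

/-- `R/I` has socle degree `e`: `e` is the largest degree with nonzero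
Hilbert function. -/
def SocleDegree (k : Type*) [Field k] (r : ℕ)
    (I : Ideal (MvPolynomial (Fin r) k)) (e : ℕ) : Prop :=
  hilb k r I e ≠ 0 ∧ ∀ j : ℕ, e < j → hilb k r I j = 0

/-- `R/I` is a standard graded artinian Gorenstein algebra of socle degree `e`:
the socle vanishes below degree `e` and is one-dimensional in degree `e`. -/
def Gorenstein (k : Type*) [Field k] (r e : ℕ)
    (I : Ideal (MvPolynomial (Fin r) k)) : Prop :=
  StdArtinian k r I ∧ SocleDegree k r I e ∧
    (∀ i : ℕ, i < e → socDim k r I i = 0) ∧ socDim k r I e = 1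

/-- `R/I` is a standard graded artinian level algebra of socle degree `e`. -/
def LevelAlg (k : Type*) [Field k] (r e : ℕ)
    (I : Ideal (MvPolynomial (Fin r) k)) : Prop :=
  StdArtinian k r I ∧ SocleDegree k r I e ∧
    (∀ i : ℕ, i < e → socDim k r I i = 0)

/-- The linear form with coefficient vector `c`. -/
noncomputable def linForm {k : Type*} [Field k] {r : ℕ} (c : Fin r → k) :
    MvPolynomial (Fin r) k :=
  ∑ i, C (c i) * X i

/-- A property `P` holds for a general linear form: there is a nonempty
(basic) Zariski-open subset of the space of linear forms on which `P` holds. -/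
def Generically (k : Type*) [Field k] (r : ℕ)
    (P : MvPolynomial (Fin r) k → Prop) : Prop :=
  ∃ Q : MvPolynomial (Fin r) k, Q ≠ 0 ∧
    ∀ c : Fin r → k, eval c Q ≠ 0 → P (linForm c)

/-- `R/I` has the weak Lefschetz property (socle degree `e`): multiplication
by some linear form has maximal rank from each degree `i < e` to degree `i+1`. -/
def WLP (k : Type*) [Field k] (r e : ℕ)
    (I : Ideal (MvPolynomial (Fin r) k)) : Prop :=
  ∃ L : MvPolynomial (Fin r) k, L.IsHomogeneous 1 ∧
    ∀ i : ℕ, i < e →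
      Module.finrank k (Submodule.map
        (LinearMap.mulLeft k (Ideal.Quotient.mk I L)) (gradedPiece k r I i)) =
      min (hilb k r I i) (hilb k r I (i + 1))

/-- The largest `t` with `choose t i ≤ n`: the leading top in the
`i`-binomial expansion of `n`. -/
noncomputable def binTop (n i : ℕ) : ℕ := sSup {t : ℕ | Nat.choose t i ≤ n}

/-- Auxiliary recursion computing `((n)_{(i)})⁻¹₀`, i.e. the sum
`C(n_i - 1, i) + C(n_{i-1} - 1, i-1) + ⋯ + C(n_j - 1, j)` where
`n_{(i)} = C(n_i, i) + ⋯ + C(n_j, j)` is the `i`-binomial expansion of `n`. -/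
noncomputable def greenBoundAux : ℕ → ℕ → ℕ
  | 0, _ => 0
  | (i + 1), n =>
    if n = 0 then 0 else
      Nat.choose (binTop n (i + 1) - 1) (i + 1) +
        greenBoundAux i (n - Nat.choose (binTop n (i + 1)) (i + 1))

/-- `greenBound n i = ((n)_{(i)})⁻¹₀`. -/
noncomputable def greenBound (n i : ℕ) : ℕ := greenBoundAux i n

open Filter Module

/-! ### Generic points of affine space -/

/-- The filter of subsets of `σ → k` that contain a nonempty basic Zariski-open set. -/
def genericFilter (k σ : Type*) [Field k] : Filter (σ → k) where
  sets := {S | ∃ Q : MvPolynomial σ k, Q ≠ 0 ∧ ∀ t, eval t Q ≠ 0 → t ∈ S}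
  univ_sets := ⟨1, one_ne_zero, fun _ _ => Set.mem_univ _⟩
  sets_of_superset := fun ⟨Q, hQ, h⟩ hST => ⟨Q, hQ, fun t ht => hST (h t ht)⟩
  inter_sets := fun ⟨Q, hQ, h⟩ ⟨Q', hQ', h'⟩ => ⟨Q * Q', mul_ne_zero hQ hQ', fun t ht => by
    rw [map_mul] at ht
    exact ⟨h t (left_ne_zero_of_mul ht), h' t (right_ne_zero_of_mul ht)⟩⟩

theorem eventually_genericFilter {k σ : Type*} [Field k] {p : (σ → k) → Prop} :
    (∀ᶠ t in genericFilter k σ, p t) ↔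
      ∃ Q : MvPolynomial σ k, Q ≠ 0 ∧ ∀ t, eval t Q ≠ 0 → p t :=
  Iff.rfl

instance {k σ : Type*} [Field k] [Infinite k] : (genericFilter k σ).NeBot := by
  refine ⟨fun h => ?_⟩
  obtain ⟨Q, hQ, h⟩ := eventually_genericFilter.1
    (show ∀ᶠ _ in genericFilter k σ, False from h ▸ Filter.eventually_bot)
  exact hQ (MvPolynomial.funext fun t => by simpa using h t)

/-- The kernel of a linear map, restricted to a finite-dimensional subspace, has generically
the least possible dimension within a linear family of maps. -/
theorem eventually_finrank_inf_ker_le {k σ E E' : Type*} [Field k] [Fintype σ]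
    [AddCommGroup E] [Module k E] [AddCommGroup E'] [Module k E']
    (T : (σ → k) →ₗ[k] E →ₗ[k] E') (V : Submodule k E) [FiniteDimensional k V] (a : σ → k) :
    ∀ᶠ t in genericFilter k σ,
      finrank k ↥(V ⊓ LinearMap.ker (T t)) ≤ finrank k ↥(V ⊓ LinearMap.ker (T a)) := by
  classical
  obtain ⟨W, hW⟩ := Submodule.exists_isCompl ((LinearMap.ker (T a)).comap V.subtype)
  let b := Module.finBasis k W
  let n := finrank k W
  let j : (Fin n → k) →ₗ[k] E :=
    V.subtype ∘ₗ W.subtype ∘ₗ b.equivFun.symm.toLinearMap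
  have hj : LinearMap.ker (T a ∘ₗ j) = ⊥ := by
    rw [LinearMap.ker_eq_bot']
    intro x hx
    have h1 : b.equivFun.symm x = 0 := by
      have : (b.equivFun.symm x : V) ∈ (LinearMap.ker (T a)).comap V.subtype := by
        simpa [j] using hx
      have := (Submodule.disjoint_def.1 hW.disjoint) _ this (b.equivFun.symm x).2
      exact_mod_cast this
    exact b.equivFun.symm.map_eq_zero_iff.1 h1
  obtain ⟨S, hS⟩ := LinearMap.exists_leftInverse_of_injective _ hj
  let M : Matrix (Fin n) (Fin n) (MvPolynomial σ k) := Matrix.of fun i l =>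
    ∑ s, X s * C (S (T (Pi.single s 1) (j (Pi.single l 1))) i)
  have hM : ∀ t, eval t M.det = LinearMap.det (S ∘ₗ T t ∘ₗ j) := by
    intro t
    rw [← LinearMap.det_toMatrix', RingHom.map_det]
    congr 1
    ext i l
    have ht : T t = ∑ s, t s • T (Pi.single s 1) := by
      conv_lhs => rw [pi_eq_sum_univ' t]
      simp
    simp [M, LinearMap.toMatrix'_apply, ht]
  refine eventually_genericFilter.2 ⟨M.det, fun h0 => ?_, fun t ht => ?_⟩
  · have := hM a
    rw [h0, hS] at this
    simp at this
  · rw [hM] at ht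
    have hinj : LinearMap.ker (S ∘ₗ T t ∘ₗ j) = ⊥ := by
      by_contra hne
      exact ht (LinearMap.det_eq_zero_iff_ker_ne_bot.2 hne)
    have hd : Disjoint ((LinearMap.ker (T t)).comap V.subtype) W := by
      rw [Submodule.disjoint_def]
      intro x hx hxW
      have h1 : b.equivFun ⟨x, hxW⟩ ∈ LinearMap.ker (S ∘ₗ T t ∘ₗ j) := by
        have : T t (x : E) = 0 := by simpa using hx
        rw [LinearMap.mem_ker, LinearMap.comp_apply, LinearMap.comp_apply]
        simp only [j, LinearMap.comp_apply, LinearEquiv.coe_coe, LinearEquiv.symm_apply_apply,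
          Submodule.subtype_apply, this, map_zero]
      rw [hinj] at h1
      simpa using h1
    have h2 := Submodule.finrank_add_finrank_le_of_disjoint hd
    have h3 := Submodule.finrank_add_eq_of_isCompl hW
    have h4 : ∀ t, finrank k ↥((LinearMap.ker (T t)).comap V.subtype) =
        finrank k ↥(V ⊓ LinearMap.ker (T t)) := fun t => by
      rw [← Submodule.map_comap_subtype]
      exact (Submodule.equivMapOfInjective _ V.injective_subtype _).finrank_eq
    rw [← h4, ← h4]
    omega

/-- Rank-nullity for the restriction of a linear map to a subspace. -/
theorem finrank_map_add_finrank_inf_ker {k E E' : Type*} [Field k]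
    [AddCommGroup E] [Module k E] [AddCommGroup E'] [Module k E']
    (f : E →ₗ[k] E') (V : Submodule k E) [FiniteDimensional k V] :
    finrank k ↥(V.map f) + finrank k ↥(V ⊓ LinearMap.ker f) = finrank k V := by
  have h := (f.domRestrict V).finrank_range_add_finrank_ker
  rw [LinearMap.range_domRestrict, LinearMap.ker_domRestrict] at h
  rw [← h]
  congr 1
  rw [← Submodule.map_comap_subtype]
  exact (Submodule.equivMapOfInjective _ V.injective_subtype _).symm.finrank_eq

/-- A proper subspace of affine space contains no generic point. -/
theorem eventually_notMem {k : Type*} [Field k] {r : ℕ} {N : Submodule k (Fin r → k)}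
    (hN : N ≠ ⊤) : ∀ᶠ t in genericFilter k (Fin r), t ∉ N := by
  obtain ⟨a, ha⟩ := SetLike.exists_not_mem_of_ne_top N hN rfl
  obtain ⟨φ, hφ, hNφ⟩ := Submodule.exists_le_ker_of_notMem ha
  have ht : ∀ t, φ t = ∑ s, t s * φ (Pi.single s 1) := by
    intro t
    conv_lhs => rw [← Finset.univ_sum_single t]
    rw [map_sum]
    refine Finset.sum_congr rfl fun s _ => ?_
    rw [← smul_eq_mul, ← map_smul, ← Pi.single_smul, smul_eq_mul, mul_one]
  refine eventually_genericFilter.2 ⟨∑ s, X s * C (φ (Pi.single s 1)), ?_, ?_⟩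
  · rintro h0
    apply hφ
    rw [ht]
    simpa using congrArg (eval a) h0
  · intro t h htN
    apply h
    have := hNφ htN
    rw [LinearMap.mem_ker, ht] at this
    simpa using this

/-- Two vectors outside a subspace are detected by a common functional vanishing on it. -/
theorem exists_dual_ne_zero_of_notMem {k A : Type*} [Field k] [AddCommGroup A] [Module k A]
    {N : Submodule k A} {a b : A} (ha : a ∉ N) (hb : b ∉ N) :
    ∃ φ : Dual k A, N ≤ LinearMap.ker φ ∧ φ a ≠ 0 ∧ φ b ≠ 0 := by
  obtain ⟨f, hf, hNf⟩ := Submodule.exists_le_ker_of_notMem ha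
  obtain ⟨g, hg, hNg⟩ := Submodule.exists_le_ker_of_notMem hb
  by_cases h1 : f b = 0
  · by_cases h2 : g a = 0
    · refine ⟨f + g, fun x hx => ?_, by simpa [h2], by simpa [h1]⟩
      have := hNf hx
      have := hNg hx
      simp_all
    · exact ⟨g, hNg, h2, hg⟩
  · exact ⟨f, hNf, hf, h1⟩

/-! ### Binomial coefficients with a real parameter -/

/-- The polynomial `x ↦ C(x + d, d)` on the reals. -/
noncomputable def realBinom (d : ℕ) (x : ℝ) : ℝ := ∏ i ∈ Finset.range d, (x + i + 1) / (i + 1)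

theorem realBinom_succ (d : ℕ) (x : ℝ) :
    realBinom (d + 1) x = realBinom d x * ((x + d + 1) / (d + 1)) :=
  Finset.prod_range_succ _ _

theorem realBinom_one (x : ℝ) : realBinom 1 x = x + 1 := by
  simp [realBinom]

theorem realBinom_sub_one_mul (d : ℕ) (x : ℝ) :
    realBinom d (x - 1) * (x + d) = realBinom d x * x := by
  induction d with
  | zero => simp [realBinom]
  | succ d ih =>
    rw [realBinom_succ, realBinom_succ]
    push_cast
    have : (d : ℝ) + 1 ≠ 0 := by positivity
    field_simp
    linear_combination (x + d + 1) * ih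

theorem realBinom_pascal (d : ℕ) (x : ℝ) :
    realBinom (d + 1) x = realBinom (d + 1) (x - 1) + realBinom d x := by
  rw [realBinom_succ, realBinom_succ]
  have : (d : ℝ) + 1 ≠ 0 := by positivity
  field_simp
  linear_combination - realBinom_sub_one_mul d x

theorem realBinom_natCast (d m : ℕ) : realBinom d m = (m + d).choose d := by
  induction d with
  | zero => simp [realBinom]
  | succ d ih =>
    rw [realBinom_succ, ih]
    have h := Nat.add_one_mul_choose_eq (m + d) d
    have : (d : ℝ) + 1 ≠ 0 := by positivity
    field_simp
    rw [← add_assoc]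
    rw [mul_comm] at h
    exact_mod_cast h.trans (mul_comm _ _)

theorem realBinom_nonneg {d : ℕ} {x : ℝ} (hx : -1 ≤ x) : 0 ≤ realBinom d x :=
  Finset.prod_nonneg fun i _ =>
    div_nonneg (by linarith [(Nat.cast_nonneg i : (0 : ℝ) ≤ i)]) (by positivity)

theorem realBinom_lt {d : ℕ} {x y : ℝ} (hx : -1 ≤ x) (hxy : x < y) :
    realBinom (d + 1) x < realBinom (d + 1) y := by
  induction d with
  | zero => simpa [realBinom_one] using hxy
  | succ d ih =>
    rw [realBinom_succ _ x, realBinom_succ _ y]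
    refine mul_lt_mul'' ih ?_ (realBinom_nonneg hx) ?_
    · gcongr
    · have : (0 : ℝ) ≤ d := d.cast_nonneg
      push_cast
      exact div_nonneg (by linarith) (by linarith)

theorem realBinom_le {d : ℕ} {x y : ℝ} (hx : -1 ≤ x) (hxy : x ≤ y) :
    realBinom (d + 1) x ≤ realBinom (d + 1) y := by
  rcases hxy.eq_or_lt with rfl | h
  · rfl
  · exact (realBinom_lt hx h).le

theorem exists_realBinom_eq {d n : ℕ} (hn : 1 ≤ n) :
    ∃ y : ℝ, 0 ≤ y ∧ realBinom (d + 1) y = n := by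
  have hc : Continuous (realBinom (d + 1)) := by
    unfold realBinom
    fun_prop
  have h0 : realBinom (d + 1) 0 = 1 := by simpa using realBinom_natCast (d + 1) 0
  have hle : (n : ℝ) ≤ realBinom (d + 1) n := by
    rw [realBinom_natCast]
    have h1 : (n + 1).choose 1 ≤ (n + (d + 1)).choose (d + 1) := by
      rw [← Nat.choose_symm_add, ← Nat.choose_symm_add]
      exact Nat.choose_le_choose n (by omega)
    rw [Nat.choose_one_right] at h1
    exact_mod_cast (by omega : n ≤ (n + (d + 1)).choose (d + 1))
  obtain ⟨y, hy, h⟩ := intermediate_value_Icc (Nat.cast_nonneg n) hc.continuousOn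
    (show (n : ℝ) ∈ Set.Icc _ _ from ⟨by rw [h0]; exact_mod_cast hn, hle⟩)
  exact ⟨y, hy.1, h⟩

/-! ### Contraction of functionals by linear forms -/

section Contraction

variable {k : Type*} [Field k] {r : ℕ}

theorem linForm_add (c c' : Fin r → k) : linForm (c + c') = linForm c + linForm c' := by
  simp [linForm, add_mul, Finset.sum_add_distrib]

theorem linForm_smul (a : k) (c : Fin r → k) : linForm (a • c) = a • linForm c := by
  simp [linForm, Finset.smul_sum, smul_eq_C_mul, mul_assoc]

theorem linForm_single (i : Fin r) : linForm (Pi.single i (1 : k)) = X i := by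
  rw [linForm, Finset.sum_eq_single i]
  · simp
  · intro j _ hj
    simp [hj]
  · simp

theorem isHomogeneous_linForm (c : Fin r → k) : (linForm c).IsHomogeneous 1 :=
  IsHomogeneous.sum _ _ _ fun i _ => isHomogeneous_C_mul_X (c i) i

theorem homogeneousComponent_succ_linForm_mul (c : Fin r → k) (d : ℕ)
    (f : MvPolynomial (Fin r) k) :
    homogeneousComponent (d + 1) (linForm c * f) = linForm c * homogeneousComponent d f := by
  induction f using MvPolynomial.induction_on' with
  | monomial s a =>
    have h1 := isHomogeneous_monomial (R := k) a (n := s.degree) (d := s) rfl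
    have h2 := (isHomogeneous_linForm c).mul h1
    rw [homogeneousComponent_of_mem h1, homogeneousComponent_of_mem h2]
    by_cases h : d = s.degree
    · rw [if_pos h, if_pos (by omega)]
    · rw [if_neg h, if_neg (by omega), mul_zero]
  | add p q hp hq => rw [mul_add, map_add, map_add, hp, hq, mul_add]

/-- Contraction of a functional on polynomials by the linear form with given coefficients. -/
noncomputable def contract :
    (Fin r → k) →ₗ[k] Dual k (MvPolynomial (Fin r) k) →ₗ[k] Dual k (MvPolynomial (Fin r) k) :=
  LinearMap.mk₂ k (fun c F => F ∘ₗ LinearMap.mulLeft k (linForm c))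
    (fun c c' F => LinearMap.ext fun f => by simp [linForm_add, add_mul])
    (fun a c F => LinearMap.ext fun f => by simp [linForm_smul])
    (fun _ _ _ => rfl) (fun _ _ _ => rfl)

theorem contract_apply (c : Fin r → k) (F : Dual k (MvPolynomial (Fin r) k))
    (f : MvPolynomial (Fin r) k) : contract c F f = F (linForm c * f) := rfl

theorem contract_comm (c c' : Fin r → k) (F : Dual k (MvPolynomial (Fin r) k)) :
    contract c (contract c' F) = contract c' (contract c F) := by
  refine LinearMap.ext fun f => ?_
  simp only [contract_apply, mul_left_comm]

variable (k r) in
/-- The functionals on polynomials that only see the homogeneous component of degree `d`. -/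
def dualForms (d : ℕ) : Submodule k (Dual k (MvPolynomial (Fin r) k)) where
  carrier := {F | ∀ f, F (homogeneousComponent d f) = F f}
  add_mem' hF hG f := by simp [hF f, hG f]
  zero_mem' f := rfl
  smul_mem' a F hF f := by simp [hF f]

theorem contract_mem_dualForms {d : ℕ} {F : Dual k (MvPolynomial (Fin r) k)}
    (hF : F ∈ dualForms k r (d + 1)) (c : Fin r → k) : contract c F ∈ dualForms k r d := by
  intro f
  rw [contract_apply, contract_apply, ← homogeneousComponent_succ_linForm_mul, hF]

theorem eq_zero_of_contract_eq_zero {d : ℕ} {F : Dual k (MvPolynomial (Fin r) k)}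
    (hF : F ∈ dualForms k r (d + 1)) (h : ∀ c, contract c F = 0) : F = 0 := by
  suffices hm : ∀ s a, F (monomial s a) = 0 by
    refine LinearMap.ext fun f => ?_
    induction f using MvPolynomial.induction_on' with
    | monomial s a => exact hm s a
    | add p q hp hq => rw [map_add, hp, hq, map_add]
  intro s a
  by_cases hs : s = 0
  · subst hs
    rw [← hF, homogeneousComponent_of_mem (isHomogeneous_monomial a rfl), if_neg (by simp),
      map_zero]
  · obtain ⟨i, hi⟩ := Finsupp.ne_iff.1 hs
    have hle : Finsupp.single i 1 ≤ s := by
      simpa [Finsupp.single_le_iff, Nat.one_le_iff_ne_zero] using hi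
    have h1 : monomial s a = linForm (Pi.single i (1 : k)) *
        monomial (s - Finsupp.single i 1) a := by
      rw [linForm_single, X, monomial_mul, one_mul, add_tsub_cancel_of_le hle]
    rw [h1, ← contract_apply, h, LinearMap.zero_apply]

instance (d : ℕ) : FiniteDimensional k (dualForms k r d) := by
  have : Module.Finite k (homogeneousSubmodule (Fin r) k d) :=
    Module.Finite.iff_fg.2 (homogeneousSubmodule_fg _ _ d)
  let res : dualForms k r d →ₗ[k] Dual k (homogeneousSubmodule (Fin r) k d) :=
    (homogeneousSubmodule (Fin r) k d).subtype.dualMap ∘ₗ (dualForms k r d).subtype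
  refine FiniteDimensional.of_injective res ((injective_iff_map_eq_zero _).2 fun F hF => ?_)
  ext1
  refine LinearMap.ext fun f => ?_
  rw [← F.2 f]
  exact LinearMap.congr_fun hF ⟨_, homogeneousComponent_mem d f⟩

theorem finiteDimensional_of_le_dualForms {V : Submodule k (Dual k (MvPolynomial (Fin r) k))}
    {d : ℕ} (hV : V ≤ dualForms k r d) : FiniteDimensional k V :=
  Submodule.finiteDimensional_of_le hV

theorem eq_zero_of_apply_one_eq_zero {F : Dual k (MvPolynomial (Fin r) k)}
    (hF : F ∈ dualForms k r 0) (h : F 1 = 0) : F = 0 := by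
  refine LinearMap.ext fun f => ?_
  rw [← hF, homogeneousComponent_zero, ← mul_one (C _), ← smul_eq_C_mul, map_smul, h, smul_zero,
    LinearMap.zero_apply]

theorem finrank_dualForms_zero_le : finrank k (dualForms k r 0) ≤ 1 := by
  let ε : dualForms k r 0 →ₗ[k] k := LinearMap.applyₗ 1 ∘ₗ (dualForms k r 0).subtype
  have hε : Function.Injective ε := (injective_iff_map_eq_zero _).2 fun F hF =>
    Subtype.ext (eq_zero_of_apply_one_eq_zero F.2 hF)
  simpa using LinearMap.finrank_le_finrank_of_injective hε

/-- Evaluation of the degree `d` component at the point with coordinates `φ (e i)`. -/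
noncomputable def evalForm (φ : Dual k (Fin r → k)) (d : ℕ) : Dual k (MvPolynomial (Fin r) k) :=
  (aeval fun i => φ (Pi.single i 1)).toLinearMap ∘ₗ homogeneousComponent d

theorem evalForm_mem (φ : Dual k (Fin r → k)) (d : ℕ) : evalForm φ d ∈ dualForms k r d := by
  intro f
  simp [evalForm, homogeneousComponent_eq_self (homogeneousComponent_isHomogeneous d f)]

theorem contract_evalForm_succ (φ : Dual k (Fin r → k)) (d : ℕ) (c : Fin r → k) :
    contract c (evalForm φ (d + 1)) = φ c • evalForm φ d := by
  refine LinearMap.ext fun f => ?_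
  have : φ c = ∑ i, c i * φ (Pi.single i 1) := by
    conv_lhs => rw [← Finset.univ_sum_single c]
    rw [map_sum]
    refine Finset.sum_congr rfl fun s _ => ?_
    rw [← smul_eq_mul, ← map_smul, ← Pi.single_smul, smul_eq_mul, mul_one]
  simp only [contract_apply, evalForm, LinearMap.comp_apply, homogeneousComponent_succ_linForm_mul,
    LinearMap.smul_apply]
  simp [this, linForm]

theorem evalForm_ne_zero {φ : Dual k (Fin r → k)} {c : Fin r → k} (hc : φ c ≠ 0) (d : ℕ) :
    evalForm φ d ≠ 0 := by
  induction d with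
  | zero =>
    intro h
    have := LinearMap.congr_fun h 1
    simp [evalForm] at this
  | succ d ih =>
    intro h
    have := contract_evalForm_succ φ d c
    rw [h, map_zero] at this
    exact smul_ne_zero hc ih this.symm

/-- The degree `d` functionals annihilated by contraction with every element of `N`. -/
noncomputable def perpForms (d : ℕ) (N : Submodule k (Fin r → k)) :
    Submodule k (Dual k (MvPolynomial (Fin r) k)) :=
  dualForms k r d ⊓ ⨅ c ∈ N, LinearMap.ker (contract c)

theorem mem_perpForms {d : ℕ} {N : Submodule k (Fin r → k)}
    {F : Dual k (MvPolynomial (Fin r) k)} :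
    F ∈ perpForms d N ↔ F ∈ dualForms k r d ∧ ∀ c ∈ N, contract c F = 0 := by
  simp [perpForms]

theorem evalForm_mem_perpForms {φ : Dual k (Fin r → k)} {N : Submodule k (Fin r → k)}
    (hφ : N ≤ LinearMap.ker φ) (d : ℕ) : evalForm φ (d + 1) ∈ perpForms (d + 1) N := by
  refine mem_perpForms.2 ⟨evalForm_mem _ _, fun c hc => ?_⟩
  rw [contract_evalForm_succ, LinearMap.mem_ker.1 (hφ hc), zero_smul]

theorem perpForms_le (d : ℕ) (N : Submodule k (Fin r → k)) : perpForms d N ≤ dualForms k r d :=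
  inf_le_left

theorem finrank_perpForms_le (d s : ℕ) (N : Submodule k (Fin r → k)) (hN : finrank k N + s = r) :
    finrank k (perpForms d N) ≤ s.multichoose d := by
  induction d generalizing s N with
  | zero =>
    rw [Nat.multichoose_zero_right]
    exact (Submodule.finrank_mono (perpForms_le 0 N)).trans finrank_dualForms_zero_le
  | succ d ihd =>
    induction s generalizing N with
    | zero =>
      have htop : N = ⊤ := Submodule.eq_top_of_finrank_eq (by simpa using hN)
      have : perpForms (d + 1) N = ⊥ := by
        rw [eq_bot_iff]
        intro F hF
        obtain ⟨h1, h2⟩ := mem_perpForms.1 hF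
        exact eq_zero_of_contract_eq_zero h1 fun c => h2 c (htop ▸ Submodule.mem_top)
      rw [this, finrank_bot]
      exact Nat.zero_le _
    | succ s ihs =>
      have htop : N ≠ ⊤ := by
        rintro rfl
        rw [finrank_top, finrank_fin_fun] at hN
        omega
      obtain ⟨c, hc⟩ := SetLike.exists_not_mem_of_ne_top N htop rfl
      have hN' : finrank k ↥(N ⊔ Submodule.span k {c}) + s = r := by
        rw [Submodule.finrank_sup_span_singleton hc]
        omega
      have := finiteDimensional_of_le_dualForms (perpForms_le (d + 1) N)
      rw [← finrank_map_add_finrank_inf_ker (contract c) (perpForms (d + 1) N),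
        Nat.multichoose_succ_succ, add_comm]
      have h1 : perpForms (d + 1) N ⊓ LinearMap.ker (contract c) ≤
          perpForms (d + 1) (N ⊔ Submodule.span k {c}) := by
        rintro F ⟨hF, hFc⟩
        obtain ⟨hF1, hF2⟩ := mem_perpForms.1 hF
        refine mem_perpForms.2 ⟨hF1, fun x hx => ?_⟩
        obtain ⟨y, hy, z, hz, rfl⟩ := Submodule.mem_sup.1 hx
        obtain ⟨a, rfl⟩ := Submodule.mem_span_singleton.1 hz
        simp [hF2 y hy, LinearMap.mem_ker.1 hFc]
      have h2 : (perpForms (d + 1) N).map (contract c) ≤ perpForms d N := by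
        rintro _ ⟨F, hF, rfl⟩
        obtain ⟨hF1, hF2⟩ := mem_perpForms.1 hF
        refine mem_perpForms.2 ⟨contract_mem_dualForms hF1 c, fun x hx => ?_⟩
        rw [contract_comm, hF2 x hx, map_zero]
      have := finiteDimensional_of_le_dualForms
        (perpForms_le (d + 1) (N ⊔ Submodule.span k {c}))
      have := finiteDimensional_of_le_dualForms (perpForms_le d N)
      exact add_le_add ((Submodule.finrank_mono h1).trans (ihs _ hN'))
        ((Submodule.finrank_mono h2).trans (ihd _ _ hN))

/-- The linear forms killing a space of degree-one functionals form its annihilator. -/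
theorem exists_le_perpForms_one {V : Submodule k (Dual k (MvPolynomial (Fin r) k))}
    (hV : V ≤ dualForms k r 1) :
    ∃ N : Submodule k (Fin r → k), finrank k N + finrank k V = r ∧ V ≤ perpForms 1 N := by
  let T : Dual k (MvPolynomial (Fin r) k) →ₗ[k] Dual k (Fin r → k) :=
    (LinearMap.applyₗ (1 : MvPolynomial (Fin r) k)).compRight k ∘ₗ contract.flip
  have hT : ∀ F c, T F c = contract c F 1 := fun _ _ => rfl
  have hinj : Function.Injective (T.domRestrict V) := by
    refine (injective_iff_map_eq_zero _).2 fun F hF => Subtype.ext ?_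
    refine eq_zero_of_contract_eq_zero (hV F.2) fun c => ?_
    refine eq_zero_of_apply_one_eq_zero (contract_mem_dualForms (hV F.2) c) ?_
    rw [← hT]
    exact LinearMap.congr_fun hF c
  have hfr : finrank k (V.map T) = finrank k V := by
    rw [← LinearMap.range_domRestrict]
    exact LinearMap.finrank_range_of_inj hinj
  refine ⟨(V.map T).dualCoannihilator, ?_, fun F hF => mem_perpForms.2 ⟨hV hF, fun c hc => ?_⟩⟩
  · have h := Subspace.finrank_add_finrank_dualCoannihilator_eq (V.map T)
    rw [finrank_fin_fun, hfr] at h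
    omega
  · refine eq_zero_of_apply_one_eq_zero (contract_mem_dualForms (hV hF) c) ?_
    rw [← hT]
    exact (Submodule.mem_dualCoannihilator _).1 hc _ (Submodule.mem_map_of_mem hF)

theorem eventually_contract_ne_zero {d : ℕ} {F : Dual k (MvPolynomial (Fin r) k)}
    (hF : F ∈ dualForms k r (d + 1)) (hF0 : F ≠ 0) :
    ∀ᶠ c in genericFilter k (Fin r), contract c F ≠ 0 := by
  refine (eventually_notMem (N := LinearMap.ker (contract.flip F)) fun htop => hF0 ?_).mono
    fun c hc h => hc h
  exact eq_zero_of_contract_eq_zero hF fun c =>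
    LinearMap.mem_ker.1 (htop ▸ Submodule.mem_top : c ∈ LinearMap.ker (contract.flip F))

theorem exists_eq_perpForms_one {n : ℕ} {V : Submodule k (Dual k (MvPolynomial (Fin r) k))}
    (hV : V ≤ dualForms k r 1) (hfr : finrank k V = n) :
    ∃ N : Submodule k (Fin r → k), finrank k N + n = r ∧ V = perpForms 1 N := by
  obtain ⟨N, hN, hVN⟩ := exists_le_perpForms_one hV
  rw [hfr] at hN
  have := finiteDimensional_of_le_dualForms (perpForms_le 1 N)
  refine ⟨N, hN, Submodule.eq_of_le_of_finrank_le hVN ?_⟩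
  have := finrank_perpForms_le 1 n N hN
  rwa [Nat.multichoose_one_right, ← hfr] at this

theorem le_of_perpForms_le_of_map_le {d : ℕ} {N N' : Submodule k (Fin r → k)}
    {V : Submodule k (Dual k (MvPolynomial (Fin r) k))} (hN : perpForms (d + 2) N ≤ V)
    {c : Fin r → k} (hc : V.map (contract c) ≤ perpForms (d + 1) N') (hcN : c ∉ N) : N' ≤ N := by
  intro x hx
  by_contra hxN
  obtain ⟨φ, hφ, hφc, hφx⟩ := exists_dual_ne_zero_of_notMem hcN hxN
  have h := (mem_perpForms.1
    (hc (Submodule.mem_map_of_mem (hN (evalForm_mem_perpForms hφ (d + 1)))))).2 x hx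
  rw [contract_evalForm_succ, map_smul, contract_evalForm_succ] at h
  exact smul_ne_zero hφc (smul_ne_zero hφx (evalForm_ne_zero hφx d)) h

/-- Outside characteristic two, a nonzero quadratic functional has a nonzero generic value. -/
theorem eventually_contract_contract_self_ne_zero (hchar : (2 : k) ≠ 0)
    {F : Dual k (MvPolynomial (Fin r) k)} (hF : F ∈ dualForms k r 2) (hF0 : F ≠ 0) :
    ∀ᶠ c in genericFilter k (Fin r), contract c (contract c F) ≠ 0 := by
  obtain ⟨c, hc⟩ : ∃ c, contract c (contract c F) ≠ 0 := by
    by_contra! h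
    refine hF0 (eq_zero_of_contract_eq_zero hF fun a =>
      eq_zero_of_contract_eq_zero (contract_mem_dualForms hF a) fun b => ?_)
    have hab := h (a + b)
    simp only [map_add, LinearMap.add_apply, h, zero_add, add_zero] at hab
    rw [contract_comm a b, ← two_smul k] at hab
    exact (smul_eq_zero.1 hab).resolve_left hchar
  let Q : MvPolynomial (Fin r) k := ∑ i, ∑ j, X i * (X j * C (F (X i * X j)))
  have hQ : ∀ c, eval c Q = contract c (contract c F) 1 := by
    intro c
    rw [contract_apply, contract_apply, mul_one, linForm, Finset.sum_mul_sum]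
    simp only [Q, map_sum, map_mul, eval_X, eval_C]
    refine Finset.sum_congr rfl fun i _ => Finset.sum_congr rfl fun j _ => ?_
    rw [mul_mul_mul_comm, ← C_mul, ← smul_eq_C_mul, map_smul, smul_eq_mul, mul_assoc]
  refine eventually_genericFilter.2 ⟨Q, fun h0 => hc ?_, fun c' hc' h0 => hc' ?_⟩
  · refine eq_zero_of_apply_one_eq_zero
      (contract_mem_dualForms (contract_mem_dualForms hF c) c) ?_
    rw [← hQ, h0, map_zero]
  · rw [hQ, h0, LinearMap.zero_apply]

/-! ### Green's hyperplane restriction bound -/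

/-- Generically, contraction by a linear form has the least possible kernel on `V`. -/
theorem eventually_finrank_inf_ker_contract_le
    (V : Submodule k (Dual k (MvPolynomial (Fin r) k))) [FiniteDimensional k V] (a : Fin r → k) :
    ∀ᶠ c in genericFilter k (Fin r),
      finrank k ↥(V ⊓ LinearMap.ker (contract c)) ≤
        finrank k ↥(V ⊓ LinearMap.ker (contract a)) := by
  exact @eventually_finrank_inf_ker_le k (Fin r) (Dual k (MvPolynomial (Fin r) k))
    (Dual k (MvPolynomial (Fin r) k)) _ _ _ _ _ _ contract V _ a

/-- Contraction by `c'` maps the kernel of `c` into the kernel of `c` on the image of `c'`. -/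
theorem finrank_inf_ker_le_add (V : Submodule k (Dual k (MvPolynomial (Fin r) k)))
    [FiniteDimensional k V] (c c' : Fin r → k) :
    finrank k ↥(V ⊓ LinearMap.ker (contract c)) ≤
      finrank k ↥(V.map (contract c') ⊓ LinearMap.ker (contract c)) +
        finrank k ↥(V ⊓ LinearMap.ker (contract c) ⊓ LinearMap.ker (contract c')) := by
  rw [← finrank_map_add_finrank_inf_ker (contract c') (V ⊓ LinearMap.ker (contract c))]
  refine Nat.add_le_add_right (Submodule.finrank_mono ?_) _
  rintro _ ⟨F, ⟨hF, hFc⟩, rfl⟩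
  refine ⟨Submodule.mem_map_of_mem hF, ?_⟩
  rw [SetLike.mem_coe, LinearMap.mem_ker, contract_comm, LinearMap.mem_ker.1 hFc, map_zero]

variable [Infinite k]

theorem exists_finrank_inf_ker_contract_lt {d : ℕ}
    {V : Submodule k (Dual k (MvPolynomial (Fin r) k))}
    (hV : V ≤ dualForms k r (d + 1)) (hV0 : V ≠ ⊥) :
    ∃ c : Fin r → k, finrank k ↥(V ⊓ LinearMap.ker (contract c)) < finrank k V := by
  have := finiteDimensional_of_le_dualForms hV
  obtain ⟨F, hF, hF0⟩ := Submodule.exists_mem_ne_zero_of_ne_bot hV0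
  obtain ⟨c, hc⟩ := (eventually_contract_ne_zero (hV hF) hF0).exists
  refine ⟨c, Submodule.finrank_lt_finrank_of_lt (lt_of_le_of_ne inf_le_left fun h => hc ?_)⟩
  have := h.symm ▸ hF
  exact this.2

/-- **Green's hyperplane restriction theorem**, in a form with a real parameter. -/
theorem exists_finrank_inf_ker_contract_le (d : ℕ) {x : ℝ} (hx : 0 ≤ x)
    {V : Submodule k (Dual k (MvPolynomial (Fin r) k))} (hV : V ≤ dualForms k r (d + 1))
    (hVx : (finrank k V : ℝ) ≤ realBinom (d + 1) x) :
    ∃ c : Fin r → k,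
      (finrank k ↥(V ⊓ LinearMap.ker (contract c)) : ℝ) ≤ realBinom (d + 1) (x - 1) := by
  induction d generalizing x V with
  | zero =>
    by_cases hV0 : V = ⊥
    · subst hV0
      exact ⟨0, by rw [bot_inf_eq, finrank_bot]; simpa [realBinom_one] using hx⟩
    · obtain ⟨c, hc⟩ := exists_finrank_inf_ker_contract_lt hV hV0
      refine ⟨c, ?_⟩
      have : (finrank k ↥(V ⊓ LinearMap.ker (contract c)) : ℝ) + 1 ≤ finrank k V := by
        exact_mod_cast hc
      rw [zero_add, realBinom_one] at *
      linarith
  | succ d ihd =>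
    induction hn : finrank k V using Nat.strong_induction_on generalizing x V with
    | _ n ih =>
    subst hn
    by_cases hV0 : V = ⊥
    · subst hV0
      refine ⟨0, ?_⟩
      rw [bot_inf_eq, finrank_bot]
      simpa using realBinom_nonneg (x := x - 1) (by linarith)
    have := finiteDimensional_of_le_dualForms hV
    obtain ⟨a₀, ha₀⟩ := exists_finrank_inf_ker_contract_lt hV hV0
    -- the least kernel of contraction by one form, and of contraction by two forms
    let K : (Fin r → k) → ℕ := fun c => finrank k ↥(V ⊓ LinearMap.ker (contract c))
    let κ : (Fin r → k) → (Fin r → k) → ℕ := fun c c' =>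
      finrank k ↥(V ⊓ LinearMap.ker (contract c ∘ₗ contract c'))
    let a := Function.argmin K
    let b := Function.argmin (fun p : (Fin r → k) × (Fin r → k) => κ p.1 p.2)
    have ha : ∀ c, K a ≤ K c := fun c => Function.argmin_le K c
    have hb : ∀ c c', κ b.1 b.2 ≤ κ c c' := fun c c' => Function.argmin_le
      (fun p : (Fin r → k) × (Fin r → k) => κ p.1 p.2) (c, c')
    by_contra! hcon
    have hfam1 : ∀ c', ∀ᶠ c in genericFilter k (Fin r), κ c c' ≤ κ b.1 c' := fun c' =>
      eventually_finrank_inf_ker_le ((LinearMap.lcomp k _ (contract c')) ∘ₗ contract) V b.1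
    have hfam2 : ∀ c b', ∀ᶠ c' in genericFilter k (Fin r), κ c c' ≤ κ c b' := fun c b' =>
      eventually_finrank_inf_ker_le ((LinearMap.compRight k (contract c)) ∘ₗ contract) V b'
    obtain ⟨c, hc1, hc2⟩ :=
      ((eventually_finrank_inf_ker_contract_le V a).and (hfam1 b.2)).exists
    have hK : K c = K a := le_antisymm hc1 (ha c)
    have hpos : 1 ≤ K c := by
      have h1 := hcon c
      have h2 : 0 ≤ realBinom (d + 1 + 1) (x - 1) := realBinom_nonneg (by linarith)
      exact_mod_cast h2.trans_lt h1
    obtain ⟨y, hy, hyK⟩ := exists_realBinom_eq (d := d + 1) hpos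
    have hxy : x - 1 < y := by
      by_contra! hle
      exact (hcon c).not_ge (hyK.ge.trans (realBinom_le (by linarith) hle))
    have hKle : V ⊓ LinearMap.ker (contract c) ≤ dualForms k r (d + 1 + 1) := inf_le_left.trans hV
    obtain ⟨e, he⟩ := ih (K c) (lt_of_eq_of_lt hK ((ha a₀).trans_lt ha₀)) hy hKle hyK.ge rfl
    obtain ⟨c', hc'1, hc'2, hc'3⟩ := ((eventually_finrank_inf_ker_contract_le V a).and
      ((hfam2 c b.2).and (eventually_finrank_inf_ker_contract_le
        (V ⊓ LinearMap.ker (contract c)) e))).exists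
    have hK' : K c' = K a := le_antisymm hc'1 (ha c')
    have hmap : V.map (contract c') ≤ dualForms k r (d + 1) := by
      rintro _ ⟨F, hF, rfl⟩
      exact contract_mem_dualForms (hV hF) c'
    have hrk := finrank_map_add_finrank_inf_ker (contract c') V
    have hrkx : (finrank k ↥(V.map (contract c')) : ℝ) ≤ realBinom (d + 1) x := by
      have h1 : (finrank k ↥(V.map (contract c')) : ℝ) + K c' = finrank k V := by
        exact_mod_cast hrk
      have h2 := hcon c'
      have h3 := realBinom_pascal (d + 1) x
      change _ < (K c' : ℝ) at h2
      linarith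
    obtain ⟨e', he'⟩ := ihd hx hmap hrkx
    have hmin : finrank k ↥(V.map (contract c') ⊓ LinearMap.ker (contract c)) ≤
        finrank k ↥(V.map (contract c') ⊓ LinearMap.ker (contract e')) := by
      have h1 : ∀ f, finrank k ↥(V.map (contract c') ⊓ LinearMap.ker (contract f)) + K c' =
          κ f c' := by
        intro f
        have h2 := finrank_map_add_finrank_inf_ker (contract f) (V.map (contract c'))
        have h3 := finrank_map_add_finrank_inf_ker (contract f ∘ₗ contract c') V
        rw [Submodule.map_comp] at h3
        change _ + K c' = _ at hrk
        change _ + κ f c' = _ at h3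
        omega
      have h2 : κ c c' ≤ κ e' c' := hc'2.trans (hc2.trans (hb e' c'))
      rw [← h1, ← h1] at h2
      omega
    have hsum := finrank_inf_ker_le_add V c c'
    have h1 : (K c : ℝ) ≤ realBinom (d + 1) (x - 1) + realBinom (d + 1 + 1) (y - 1) := by
      refine le_trans (b := ((_ : ℕ) : ℝ)) (Nat.cast_le.2 hsum) ?_
      push_cast
      exact add_le_add ((Nat.cast_le.2 hmin).trans he') ((Nat.cast_le.2 hc'3).trans he)
    rw [← hyK, realBinom_pascal] at h1
    have := realBinom_lt (d := d) (by linarith) hxy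
    linarith

/-! ### The extremal case -/

theorem eq_perpForms_of_eventually_map_le {d s : ℕ}
    {V : Submodule k (Dual k (MvPolynomial (Fin r) k))} (hV : V ≤ dualForms k r (d + 2))
    {N : Submodule k (Fin r → k)} (hN : finrank k N + s = r)
    (h : ∀ᶠ c in genericFilter k (Fin r), V.map (contract c) ≤ perpForms (d + 1) N)
    (hs : s.multichoose (d + 2) ≤ finrank k V) : V = perpForms (d + 2) N := by
  have := finiteDimensional_of_le_dualForms (perpForms_le (d + 2) N)
  refine Submodule.eq_of_le_of_finrank_le (fun F hF => mem_perpForms.2 ⟨hV hF, fun x hx => ?_⟩)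
    ((finrank_perpForms_le _ _ N hN).trans hs)
  by_contra hne
  obtain ⟨c, hc, hc'⟩ :=
    (h.and (eventually_contract_ne_zero (contract_mem_dualForms (hV hF) x) hne)).exists
  refine hc' ?_
  rw [contract_comm]
  exact (mem_perpForms.1 (hc (Submodule.mem_map_of_mem hF))).2 x hx

/-- The tangent space condition at a point of a linear family of maps of maximal rank. -/
theorem contract_mem_map_of_forall_finrank_le {d : ℕ}
    {V : Submodule k (Dual k (MvPolynomial (Fin r) k))} (hV : V ≤ dualForms k r d)
    {c : Fin r → k} (hc : ∀ c', finrank k ↥(V ⊓ LinearMap.ker (contract c)) ≤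
      finrank k ↥(V ⊓ LinearMap.ker (contract c')))
    {F : Dual k (MvPolynomial (Fin r) k)} (hF : F ∈ V) (hFc : contract c F = 0)
    (e : Fin r → k) : contract e F ∈ V.map (contract c) := by
  by_contra hw
  have := finiteDimensional_of_le_dualForms hV
  let T : (Fin 2 → k) →ₗ[k] (Dual k (MvPolynomial (Fin r) k) × k) →ₗ[k]
      Dual k (MvPolynomial (Fin r) k) :=
    LinearMap.mk₂ k (fun t p => t 0 • contract c p.1 + t 1 • contract e p.1 +
        (t 0 * p.2) • contract e F)
      (fun t t' p => by simp only [Pi.add_apply]; module)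
      (fun a t p => by simp only [Pi.smul_apply, smul_eq_mul]; module)
      (fun t p p' => by simp only [Prod.fst_add, Prod.snd_add, map_add]; module)
      (fun a t p => by simp only [Prod.smul_fst, Prod.smul_snd, map_smul, smul_eq_mul]; module)
  have hT : ∀ t p, T t p = t 0 • contract c p.1 + t 1 • contract e p.1 +
        (t 0 * p.2) • contract e F := fun _ _ => rfl
  let W : Submodule k (Dual k (MvPolynomial (Fin r) k) × k) := V.prod ⊤
  have : FiniteDimensional k W := Module.Finite.iff_fg.2
    ((Module.Finite.iff_fg.1 ‹FiniteDimensional k V›).prod Module.Finite.fg_top)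
  have hinl : ∀ U : Submodule k (Dual k (MvPolynomial (Fin r) k)),
      finrank k ↥(U.map (LinearMap.inl k _ k)) = finrank k U := fun U =>
    (Submodule.equivMapOfInjective _ LinearMap.inl_injective U).finrank_eq.symm
  have hproj : ∀ i : Fin 2, ∀ᶠ t in genericFilter k (Fin 2), t i ≠ 0 := fun i =>
    (eventually_notMem (N := LinearMap.ker (LinearMap.proj i : (Fin 2 → k) →ₗ[k] k))
      fun h => by
        have : (fun _ => 1 : Fin 2 → k) ∈ LinearMap.ker (LinearMap.proj i : (Fin 2 → k) →ₗ[k] k) :=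
          h ▸ Submodule.mem_top
        simp at this)
  obtain ⟨t, ht, ht0, ht1⟩ := ((eventually_finrank_inf_ker_le T W ![1, 0]).and
    ((hproj 0).and (hproj 1))).exists
  have h1 : W ⊓ LinearMap.ker (T ![1, 0]) ≤
      (V ⊓ LinearMap.ker (contract c)).map (LinearMap.inl k _ k) := by
    rintro ⟨G, u⟩ ⟨⟨hG, -⟩, hGu⟩
    rw [SetLike.mem_coe, LinearMap.mem_ker, hT] at hGu
    simp only [Matrix.cons_val_zero, Matrix.cons_val_one, one_smul, zero_smul, add_zero,
      one_mul] at hGu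
    have hu : u = 0 := by
      by_contra hu
      refine hw ⟨-(u⁻¹ • G), V.neg_mem (V.smul_mem _ hG), ?_⟩
      rw [map_neg, map_smul, eq_neg_of_add_eq_zero_left hGu, smul_neg, neg_neg, smul_smul,
        inv_mul_cancel₀ hu, one_smul]
    subst hu
    exact ⟨G, ⟨hG, by simpa using hGu⟩, rfl⟩
  have h2 : (V ⊓ LinearMap.ker (contract (t 0 • c + t 1 • e))).map (LinearMap.inl k _ k) <
      W ⊓ LinearMap.ker (T t) := by
    refine SetLike.lt_iff_le_and_exists.2 ⟨?_, (F, -(t 1 / t 0)), ⟨⟨hF, trivial⟩, ?_⟩, ?_⟩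
    · rintro _ ⟨G, ⟨hG, hG'⟩, rfl⟩
      refine ⟨⟨hG, trivial⟩, ?_⟩
      rw [SetLike.mem_coe, LinearMap.mem_ker, hT]
      simpa using hG'
    · rw [SetLike.mem_coe, LinearMap.mem_ker, hT, hFc, smul_zero, zero_add, ← add_smul]
      have : t 1 + t 0 * -(t 1 / t 0) = 0 := by
        field_simp
        ring
      rw [this, zero_smul]
    · rintro ⟨G, -, hG⟩
      have : (0 : k) = -(t 1 / t 0) := congrArg Prod.snd hG
      exact div_ne_zero ht1 ht0 (neg_eq_zero.1 this.symm)
  have h3 := Submodule.finrank_lt_finrank_of_lt h2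
  have h4 := Submodule.finrank_mono h1
  rw [hinl] at h3 h4
  have h5 := hc (t 0 • c + t 1 • e)
  omega

/-- The kernel of contraction by a form of maximal rank on an extremal space of quadrics. -/
theorem exists_inf_ker_contract_eq_perpForms_two {n : ℕ}
    {V : Submodule k (Dual k (MvPolynomial (Fin r) k))} (hV : V ≤ dualForms k r 2)
    (hfr : finrank k V = (n + 3).choose 2) {c : Fin r → k}
    (hmin : ∀ c', finrank k ↥(V ⊓ LinearMap.ker (contract c)) ≤
      finrank k ↥(V ⊓ LinearMap.ker (contract c')))
    (hc : finrank k ↥(V ⊓ LinearMap.ker (contract c)) = (n + 2).choose 2)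
    {F : Dual k (MvPolynomial (Fin r) k)} (hF : F ∈ V) (hFc : contract c (contract c F) ≠ 0) :
    ∃ N : Submodule k (Fin r → k), finrank k N + (n + 2) = r ∧
      V.map (contract c) ≤ perpForms 1 N ∧ finrank k ↥(N ⊔ Submodule.span k {c}) + (n + 1) = r ∧
      V ⊓ LinearMap.ker (contract c) = perpForms 2 (N ⊔ Submodule.span k {c}) := by
  have := finiteDimensional_of_le_dualForms hV
  have hmap : V.map (contract c) ≤ dualForms k r 1 := by
    rintro _ ⟨G, hG, rfl⟩
    exact contract_mem_dualForms (hV hG) c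
  obtain ⟨N, hN, hVN⟩ := exists_le_perpForms_one hmap
  have hrk := finrank_map_add_finrank_inf_ker (contract c) V
  have hpascal : (n + 3).choose 2 = n + 2 + (n + 2).choose 2 := by
    rw [Nat.choose_succ_succ' (n + 2) 1, Nat.choose_one_right]
  have hN' : finrank k N + (n + 2) = r := by omega
  have hcN : c ∉ N := fun h =>
    hFc ((mem_perpForms.1 (hVN (Submodule.mem_map_of_mem hF))).2 c h)
  have hNc : finrank k ↥(N ⊔ Submodule.span k {c}) + (n + 1) = r := by
    rw [Submodule.finrank_sup_span_singleton hcN]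
    omega
  refine ⟨N, hN', hVN, hNc, ?_⟩
  have := finiteDimensional_of_le_dualForms (perpForms_le 2 (N ⊔ Submodule.span k {c}))
  refine Submodule.eq_of_le_of_finrank_le ?_ ?_
  · rintro G ⟨hG, hGc⟩
    refine mem_perpForms.2 ⟨hV hG, fun x hx => ?_⟩
    obtain ⟨y, hy, z, hz, rfl⟩ := Submodule.mem_sup.1 hx
    obtain ⟨a, rfl⟩ := Submodule.mem_span_singleton.1 hz
    have hy0 : contract y G = 0 := by
      refine eq_zero_of_contract_eq_zero (contract_mem_dualForms (hV hG) y) fun e => ?_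
      rw [contract_comm]
      exact (mem_perpForms.1
        (hVN (contract_mem_map_of_forall_finrank_le hV hmin hG hGc e))).2 y hy
    rw [map_add, map_smul, LinearMap.add_apply, LinearMap.smul_apply, hy0, LinearMap.mem_ker.1 hGc,
      smul_zero, add_zero]
  · have h := finrank_perpForms_le 2 (n + 1) _ hNc
    rwa [Nat.multichoose_eq, show n + 1 + 2 - 1 = n + 2 by omega, ← hc] at h

theorem exists_eq_perpForms_two (hchar : (2 : k) ≠ 0) {n : ℕ}
    {V : Submodule k (Dual k (MvPolynomial (Fin r) k))} (hV : V ≤ dualForms k r 2)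
    (hfr : finrank k V = (n + 3).choose 2)
    (hgen : ∀ᶠ c in genericFilter k (Fin r),
      finrank k ↥(V ⊓ LinearMap.ker (contract c)) = (n + 2).choose 2) :
    ∃ N : Submodule k (Fin r → k), finrank k N + (n + 2) = r ∧ V = perpForms 2 N := by
  have := finiteDimensional_of_le_dualForms hV
  have hmin : ∀ c', (n + 2).choose 2 ≤ finrank k ↥(V ⊓ LinearMap.ker (contract c')) := by
    intro c'
    obtain ⟨c, hc, hc'⟩ := (hgen.and (eventually_finrank_inf_ker_contract_le V c')).exists
    exact hc.symm.trans_le hc'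
  obtain ⟨F, hF, hF0⟩ := Submodule.exists_mem_ne_zero_of_ne_bot (p := V) fun h => by
    rw [h, finrank_bot] at hfr
    exact (Nat.choose_pos (by omega : 2 ≤ n + 3)).ne hfr
  let good : (Fin r → k) → Submodule k (Fin r → k) → Prop := fun c N =>
    finrank k ↥(V ⊓ LinearMap.ker (contract c)) = (n + 2).choose 2 ∧
      finrank k N + (n + 2) = r ∧ V.map (contract c) ≤ perpForms 1 N ∧
      finrank k ↥(N ⊔ Submodule.span k {c}) + (n + 1) = r ∧
      V ⊓ LinearMap.ker (contract c) = perpForms 2 (N ⊔ Submodule.span k {c})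
  have hgood : ∀ᶠ c in genericFilter k (Fin r), ∃ N, good c N := by
    filter_upwards [hgen, eventually_contract_contract_self_ne_zero hchar (hV hF) hF0]
      with c hc hFc
    obtain ⟨N, hN⟩ := exists_inf_ker_contract_eq_perpForms_two hV hfr
      (fun c' => hc.trans_le (hmin c')) hc hF hFc
    exact ⟨N, hc, hN⟩
  have hnotMem : ∀ M N, good M N → ∀ᶠ c in genericFilter k (Fin r), ∀ N', good c N' →
      M ∉ N' ⊔ Submodule.span k {c} := by
    rintro M N ⟨hM, -⟩
    obtain ⟨G, hG, hG0⟩ := Submodule.exists_mem_ne_zero_of_ne_bot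
      (p := V ⊓ LinearMap.ker (contract M)) fun h => by
        rw [h, finrank_bot] at hM
        exact (Nat.choose_pos (by omega : 2 ≤ n + 2)).ne hM
    filter_upwards [eventually_contract_ne_zero (hV hG.1) hG0]
    rintro c hGc N' ⟨hc, -, -, -, hker⟩ hMN'
    have := finiteDimensional_of_le_dualForms (inf_le_left.trans hV :
      V ⊓ LinearMap.ker (contract M) ≤ dualForms k r 2)
    have hle : V ⊓ LinearMap.ker (contract c) ≤ V ⊓ LinearMap.ker (contract M) :=
      fun H hH => ⟨hH.1, (mem_perpForms.1 (hker ▸ hH)).2 M hMN'⟩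
    have heq := Submodule.eq_of_le_of_finrank_le hle (hM.trans hc.symm).le
    exact hGc (heq ▸ hG : G ∈ V ⊓ LinearMap.ker (contract c)).2
  have hle : ∀ M N c N', good M N → good c N' → M ∉ N' ⊔ Submodule.span k {c} →
      N ≤ N' ⊔ Submodule.span k {c} := fun M N c N' hM hc =>
    le_of_perpForms_le_of_map_le (hc.2.2.2.2 ▸ inf_le_left) hM.2.2.1
  obtain ⟨M₀, N₀, h₀⟩ := hgood.exists
  refine ⟨N₀, h₀.2.1, eq_perpForms_of_eventually_map_le hV h₀.2.1 (hgood.mono ?_) ?_⟩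
  · rintro M ⟨N, hM⟩
    suffices N = N₀ from this ▸ hM.2.2.1
    by_contra hne
    have hlt : N₀ < N ⊔ N₀ := by
      refine lt_of_le_of_ne le_sup_right fun h => hne ?_
      refine Submodule.eq_of_le_of_finrank_eq (sup_eq_right.1 h.symm) ?_
      have := hM.2.1
      have := h₀.2.1
      omega
    have hlt' := Submodule.finrank_lt_finrank_of_lt hlt
    have hzle : ∀ c N', good c N' → N ⊔ N₀ ≤ N' ⊔ Submodule.span k {c} →
        N ⊔ N₀ = N' ⊔ Submodule.span k {c} := fun c N' hc hle => by
      refine Submodule.eq_of_le_of_finrank_le hle ?_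
      have := hc.2.2.2.1
      have := h₀.2.1
      omega
    obtain ⟨c₁, ⟨N₁, hc₁⟩, hM₁, h₀₁⟩ :=
      (hgood.and ((hnotMem M N hM).and (hnotMem M₀ N₀ h₀))).exists
    have h₁ := hzle c₁ N₁ hc₁ (sup_le (hle M N c₁ N₁ hM hc₁ (hM₁ N₁ hc₁))
      (hle M₀ N₀ c₁ N₁ h₀ hc₁ (h₀₁ N₁ hc₁)))
    have htop : N ⊔ N₀ ≠ ⊤ := fun h => hM₁ N₁ hc₁ (h₁ ▸ h ▸ Submodule.mem_top)
    obtain ⟨c, ⟨N', hc⟩, hMc, h₀c, hcN⟩ := (hgood.and ((hnotMem M N hM).and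
      ((hnotMem M₀ N₀ h₀).and (eventually_notMem htop)))).exists
    have h := hzle c N' hc (sup_le (hle M N c N' hM hc (hMc N' hc))
      (hle M₀ N₀ c N' h₀ hc (h₀c N' hc)))
    exact hcN (h ▸ Submodule.mem_sup_right (Submodule.mem_span_singleton_self c))
  · rw [Nat.multichoose_eq, hfr]
    rfl

/-- Equality in Green's theorem: the extremal spaces are those of all forms in few variables. -/
theorem exists_eq_perpForms (hchar : (2 : k) ≠ 0) (d n : ℕ)
    {V : Submodule k (Dual k (MvPolynomial (Fin r) k))} (hV : V ≤ dualForms k r (d + 1))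
    (hfr : finrank k V = (n + 1 + (d + 1)).choose (d + 1))
    (hgen : ∀ᶠ c in genericFilter k (Fin r),
      finrank k ↥(V ⊓ LinearMap.ker (contract c)) = (n + (d + 1)).choose (d + 1)) :
    ∃ N : Submodule k (Fin r → k), finrank k N + (n + 2) = r ∧ V = perpForms (d + 1) N := by
  induction d generalizing V with
  | zero => exact exists_eq_perpForms_one hV (hfr.trans (Nat.choose_one_right _))
  | succ d ih =>
    rcases d with _ | d
    · exact exists_eq_perpForms_two hchar hV hfr hgen
    have := finiteDimensional_of_le_dualForms hV
    have hmap : ∀ c, V.map (contract c) ≤ dualForms k r (d + 1 + 1) := by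
      rintro c _ ⟨F, hF, rfl⟩
      exact contract_mem_dualForms (hV hF) c
    have hpascal : ∀ a e : ℕ, (a + 1 + (e + 1)).choose (e + 1) =
        (a + (e + 1)).choose (e + 1) + (a + 1 + e).choose e := by
      intro a e
      rw [← add_assoc, Nat.choose_succ_succ', add_comm, add_right_comm a 1 e, add_assoc]
    have hrk : ∀ c, finrank k ↥(V ⊓ LinearMap.ker (contract c)) =
        (n + (d + 1 + 1 + 1)).choose (d + 1 + 1 + 1) →
        finrank k ↥(V.map (contract c)) = (n + 1 + (d + 1 + 1)).choose (d + 1 + 1) := by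
      intro c hc
      have h := finrank_map_add_finrank_inf_ker (contract c) V
      rw [hc, hfr, hpascal n (d + 1 + 1)] at h
      omega
    have hgood : ∀ᶠ c in genericFilter k (Fin r), ∃ N : Submodule k (Fin r → k),
        finrank k N + (n + 2) = r ∧ V.map (contract c) = perpForms (d + 1 + 1) N := by
      filter_upwards [hgen] with c hc
      refine ih (hmap c) (hrk c hc) ?_
      have := finiteDimensional_of_le_dualForms (hmap c)
      obtain ⟨e, he⟩ := exists_finrank_inf_ker_contract_le (d + 1) (x := (n + 1 : ℕ))
        (Nat.cast_nonneg _) (hmap c) (by rw [hrk c hc, realBinom_natCast])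
      obtain ⟨e', he'⟩ := exists_finrank_inf_ker_contract_le (d + 1 + 1) (x := (n : ℕ))
        (Nat.cast_nonneg _) (inf_le_left.trans hV : V ⊓ LinearMap.ker (contract c) ≤ _)
        (by rw [hc, realBinom_natCast])
      filter_upwards [hgen, eventually_finrank_inf_ker_contract_le (V.map (contract c)) e,
        eventually_finrank_inf_ker_contract_le (V ⊓ LinearMap.ker (contract c)) e']
        with M hM hMe hMe'
      refine le_antisymm ?_ ?_
      · have h := (Nat.cast_le (α := ℝ).2 hMe).trans he
        rw [Nat.cast_succ, add_sub_cancel_right, realBinom_natCast] at h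
        exact_mod_cast h
      · have h1 := finrank_inf_ker_le_add V M c
        rw [inf_right_comm, hM] at h1
        have h2 := (Nat.cast_le (α := ℝ).2 hMe').trans he'
        have h3 := realBinom_pascal (d + 1 + 1) n
        rw [realBinom_natCast, realBinom_natCast] at h3
        have h4 : ((n + (d + 1 + 1 + 1)).choose (d + 1 + 1 + 1) : ℝ) ≤
            (finrank k ↥(V.map (contract c) ⊓ LinearMap.ker (contract M)) : ℝ) +
            (finrank k ↥(V ⊓ LinearMap.ker (contract c) ⊓ LinearMap.ker (contract M)) : ℝ) := by
          exact_mod_cast h1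
        have h5 : ((n + (d + 1 + 1)).choose (d + 1 + 1) : ℝ) ≤
            finrank k ↥(V.map (contract c) ⊓ LinearMap.ker (contract M)) := by linarith
        exact_mod_cast h5
    obtain ⟨c, N, hN, hcN⟩ := hgood.exists
    refine ⟨N, hN, eq_perpForms_of_eventually_map_le hV hN ?_ ?_⟩
    · have htop : N ≠ ⊤ := by
        rintro rfl
        rw [finrank_top, finrank_fin_fun] at hN
        omega
      filter_upwards [hgood, eventually_notMem htop]
      rintro M ⟨N', hN', hMN'⟩ hM
      have hle : N' ≤ N := by
        refine le_of_perpForms_le_of_map_le (V := V.map (contract c)) hcN.ge ?_ hM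
        rintro _ ⟨_, ⟨F, hF, rfl⟩, rfl⟩
        have h := mem_perpForms.1 (hMN'.le (Submodule.mem_map_of_mem hF))
        rw [contract_comm]
        refine mem_perpForms.2 ⟨contract_mem_dualForms h.1 c, fun x hx => ?_⟩
        rw [contract_comm, h.2 x hx, map_zero]
      rw [hMN', Submodule.eq_of_le_of_finrank_eq hle (by omega)]
    · rw [Nat.multichoose_eq, hfr]
      exact (congrArg (Nat.choose · _) (by omega)).le

end Contraction

/-! ### Inverse systems of ideals -/

section InverseSystem

variable {k : Type*} [Field k] {r : ℕ}

/-- The degree `d` functionals that vanish on the degree `d` component of the ideal `I`. -/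
noncomputable def inverseSystem (I : Ideal (MvPolynomial (Fin r) k)) (d : ℕ) :
    Submodule k (Dual k (MvPolynomial (Fin r) k)) :=
  ((I.restrictScalars k).comap (homogeneousComponent d)).dualAnnihilator

theorem mem_inverseSystem {I : Ideal (MvPolynomial (Fin r) k)} {d : ℕ}
    {F : Dual k (MvPolynomial (Fin r) k)} :
    F ∈ inverseSystem I d ↔ ∀ f, homogeneousComponent d f ∈ I → F f = 0 :=
  Submodule.mem_dualAnnihilator _

theorem homogeneousComponent_idem (d : ℕ) (f : MvPolynomial (Fin r) k) :
    homogeneousComponent d (homogeneousComponent d f) = homogeneousComponent d f :=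
  homogeneousComponent_eq_self (homogeneousComponent_isHomogeneous d f)

theorem inverseSystem_le_dualForms (I : Ideal (MvPolynomial (Fin r) k)) (d : ℕ) :
    inverseSystem I d ≤ dualForms k r d := by
  intro F hF f
  rw [← sub_eq_zero, ← map_sub]
  refine mem_inverseSystem.1 hF _ ?_
  rw [map_sub, homogeneousComponent_idem, sub_self]
  exact I.zero_mem

theorem finrank_inverseSystem (I : Ideal (MvPolynomial (Fin r) k)) (d : ℕ) :
    finrank k (inverseSystem I d) = hilb k r I d := by
  let p : MvPolynomial (Fin r) k →ₗ[k] gradedPiece k r I d :=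
    ((Ideal.Quotient.mkₐ k I).toLinearMap ∘ₗ homogeneousComponent d).codRestrict _ fun f =>
      Submodule.mem_map_of_mem (homogeneousComponent_mem d f)
  have hp : Function.Surjective p := by
    rintro ⟨_, f, hf, rfl⟩
    refine ⟨f, Subtype.ext ?_⟩
    exact congrArg (Ideal.Quotient.mkₐ k I) (homogeneousComponent_eq_self hf)
  have hker : LinearMap.ker p = (I.restrictScalars k).comap (homogeneousComponent d) := by
    ext f
    rw [LinearMap.mem_ker, Subtype.ext_iff]
    exact Ideal.Quotient.eq_zero_iff_mem
  rw [inverseSystem, ← hker, ← LinearMap.range_dualMap_eq_dualAnnihilator_ker_of_surjective p hp,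
    LinearMap.finrank_range_of_inj (LinearMap.dualMap_injective_of_surjective hp),
    Subspace.dual_finrank_eq]
  rfl

theorem inverseSystem_sup_span_linForm {I : Ideal (MvPolynomial (Fin r) k)} (hI : IsHomogIdeal I)
    (d : ℕ) (c : Fin r → k) :
    inverseSystem (I ⊔ Ideal.span {linForm c}) (d + 1) =
      inverseSystem I (d + 1) ⊓ LinearMap.ker (contract c) := by
  ext F
  constructor
  · intro hF
    rw [mem_inverseSystem] at hF
    refine ⟨mem_inverseSystem.2 fun f hf => hF f (Ideal.mem_sup_left hf), ?_⟩
    refine LinearMap.ext fun f => hF _ (Ideal.mem_sup_right ?_)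
    rw [LinearMap.mulLeft_apply, homogeneousComponent_succ_linForm_mul]
    exact Ideal.mul_mem_right _ _ (Ideal.mem_span_singleton_self _)
  · rintro ⟨hF, hFc⟩
    refine mem_inverseSystem.2 fun f hf => ?_
    obtain ⟨i, hi, g, hg, hfig⟩ := Submodule.mem_sup.1 hf
    obtain ⟨a, rfl⟩ := Ideal.mem_span_singleton'.1 hg
    rw [← inverseSystem_le_dualForms I (d + 1) hF, ← hfig, map_add,
      mem_inverseSystem.1 hF i (hI i hi _), zero_add, mul_comm]
    exact LinearMap.congr_fun hFc a

theorem linForm_injective :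
    Function.Injective (linForm : (Fin r → k) → MvPolynomial (Fin r) k) := by
  intro c c' h
  ext i
  simpa [linForm, Pi.single_apply] using congrArg (eval (Pi.single i 1)) h

/-- An ideal whose degree `d` inverse system is killed exactly by `N` is generated in degree `d`
by the linear forms in `N`. -/
theorem inf_homogeneousSubmodule_eq_iSup_of_inverseSystem_eq {ι : Type*}
    {I : Ideal (MvPolynomial (Fin r) k)} {d : ℕ} {N : Submodule k (Fin r → k)}
    (hIN : inverseSystem I (d + 1) = perpForms (d + 1) N) {b : ι → Fin r → k}
    (hb : Submodule.span k (Set.range b) = N) :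
    Submodule.restrictScalars k I ⊓ homogeneousSubmodule (Fin r) k (d + 1) =
      ⨆ i, (homogeneousSubmodule (Fin r) k d).map (LinearMap.mulLeft k (linForm (b i))) := by
  apply le_antisymm
  · rintro f ⟨hfI, hfd⟩
    by_contra hf
    obtain ⟨F, hFf, hF⟩ := Submodule.exists_le_ker_of_notMem hf
    have hperp : F ∘ₗ homogeneousComponent (d + 1) ∈ perpForms (d + 1) N := by
      refine mem_perpForms.2 ⟨fun g => ?_, fun c hc => ?_⟩
      · rw [LinearMap.comp_apply, homogeneousComponent_idem, LinearMap.comp_apply]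
      · suffices N ≤ LinearMap.ker (contract.flip (F ∘ₗ homogeneousComponent (d + 1))) from
          this hc
        rw [← hb, Submodule.span_le]
        rintro _ ⟨i, rfl⟩
        refine LinearMap.ext fun g => ?_
        rw [LinearMap.flip_apply, contract_apply, LinearMap.comp_apply,
          homogeneousComponent_succ_linForm_mul]
        exact hF (Submodule.mem_iSup_of_mem i
          (Submodule.mem_map_of_mem (homogeneousComponent_mem d g)))
    rw [← hIN, mem_inverseSystem] at hperp
    have hfd' := homogeneousComponent_eq_self hfd
    refine hFf ?_
    rw [← hfd']
    exact hperp f (by rwa [hfd'])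
  · refine iSup_le fun i => ?_
    rintro _ ⟨g, hg, rfl⟩
    rw [LinearMap.mulLeft_apply]
    have hg' : homogeneousComponent (d + 1) (linForm (b i) * g) = linForm (b i) * g := by
      rw [homogeneousComponent_succ_linForm_mul, homogeneousComponent_eq_self hg]
    refine ⟨?_, hg' ▸ homogeneousComponent_mem (d + 1) (linForm (b i) * g)⟩
    by_contra hgI
    have hgI' : linForm (b i) * g ∉
        (I.restrictScalars k).comap (homogeneousComponent (d + 1)) := fun h => hgI (hg' ▸ h)
    obtain ⟨F, hFg, hF⟩ := Submodule.exists_le_ker_of_notMem hgI'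
    have hFI : F ∈ inverseSystem I (d + 1) := mem_inverseSystem.2 fun f hf => hF hf
    rw [hIN, mem_perpForms] at hFI
    exact hFg (LinearMap.congr_fun (hFI.2 (b i) (hb ▸ Submodule.subset_span ⟨i, rfl⟩)) g)

end InverseSystem

/-- **Green's Theorem 3.** Assume `char k ≠ 2`. If `dim_k (R/I)_d = C(m+d,d)`
and for a general linear form `L` one has `dim_k (R/(I+(L)))_d = C(m-1+d,d)`,
then `I_d = R_{d-1} · ⟨L_1, …, L_{r-m-1}⟩` for linearly independent linear
forms `L_1, …, L_{r-m-1}`. -/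
theorem green_theorem_3
    (k : Type*) [Field k] [Infinite k] (hchar : (2 : k) ≠ 0)
    (r d m : ℕ) (hd : 1 ≤ d) (hm : 1 ≤ m) (hmr : m ≤ r - 1)
    (I : Ideal (MvPolynomial (Fin r) k)) (hI : IsHomogIdeal I)
    (hhd : hilb k r I d = Nat.choose (m + d) d)
    (hgen : Generically k r (fun L =>
      hilb k r (I ⊔ Ideal.span {L}) d = Nat.choose (m - 1 + d) d)) :
    ∃ L : Fin (r - m - 1) → MvPolynomial (Fin r) k,
      (∀ i, (L i).IsHomogeneous 1) ∧ LinearIndependent k L ∧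
      Submodule.restrictScalars k I ⊓ homogeneousSubmodule (Fin r) k d =
        ⨆ i : Fin (r - m - 1), Submodule.map (LinearMap.mulLeft k (L i))
          (homogeneousSubmodule (Fin r) k (d - 1)) := by
  obtain ⟨d, rfl⟩ := Nat.exists_eq_add_of_le' hd
  obtain ⟨n, rfl⟩ := Nat.exists_eq_add_of_le' hm
  obtain ⟨N, hN, hIN⟩ := exists_eq_perpForms hchar d n (inverseSystem_le_dualForms I (d + 1))
    ((finrank_inverseSystem I (d + 1)).trans hhd) ((eventually_genericFilter.2 hgen).mono
      fun c hc => by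
        rw [← inverseSystem_sup_span_linForm hI, finrank_inverseSystem]
        exact hc)
  let b := Module.finBasisOfFinrankEq k N (by omega : finrank k N = r - (n + 1) - 1)
  have hb : Submodule.span k (Set.range fun i => (b i : Fin r → k)) = N := by
    rw [show (fun i => (b i : Fin r → k)) = N.subtype ∘ b from rfl, Set.range_comp,
      Submodule.span_image, b.span_eq, Submodule.map_top, Submodule.range_subtype]
  let T : (Fin r → k) →ₗ[k] MvPolynomial (Fin r) k :=
    { toFun := linForm, map_add' := linForm_add, map_smul' := linForm_smul }
  have hT : LinearMap.ker T = ⊥ := LinearMap.ker_eq_bot.2 linForm_injective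
  exact ⟨fun i => linForm (b i), fun i => isHomogeneous_linForm _,
    (b.linearIndependent.map' N.subtype N.ker_subtype).map' T hT,
    inf_homogeneousSubmodule_eq_iSup_of_inverseSystem_eq hIN hb⟩
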